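/- (Dir and GateStatus Corollary) Assume d_min ≥ d_close + d_open. In a regular run, call t > 0 a positive significant moment of Dir if Dir(t+) ≠ Dir(t), and a positive significant moment of GateStatus if GateStatus(t+) ≠ GateStatus(t). Then: (1) if the positive significant moments of Dir form an infinite increasing sequence γ_1 < γ_2 < γ_3 < …, then the positive significant moments of GateStatus form an infinite increasing sequence δ_1 < δ_2 < δ_3 < … with δ_i ∈ (γ_i, γ_{i+1}) for every i ≥ 1; (2) if the positive significant moments of Dir form a finite sequence γ_1 < γ_2 < … < γ_n, then the positive significant moments of GateStatus form a finite sequence δ_1 < δ_2 < … < δ_n of the same length n, with δ_i ∈ (γ_i, γ_{i+1}) for every i < n and δ_n > γ_n. -/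

import Mathlib

namespace RailCross

inductive TStat : Type
  | emp | coming | incrossing
deriving DecidableEq

inductive DirV : Type
  | opn | cls
deriving DecidableEq

inductive GateV : Type
  | opened | closed
deriving DecidableEq

/-- `f` is piecewise constant on `[0, ∞)`: for every `τ > 0` there is a finite
partition `0 = s 0 < s 1 < … < s n = τ` such that `f` is constant on each open
subinterval `(s i, s (i+1))`. -/
def PWC {Y : Type*} (f : ℝ → Y) : Prop :=
  ∀ τ : ℝ, 0 < τ → ∃ n : ℕ, ∃ s : ℕ → ℝ,
    s 0 = 0 ∧ s n = τ ∧ (∀ i < n, s i < s (i + 1)) ∧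
    (∀ i < n, ∀ a b : ℝ, s i < a → a < b → b < s (i + 1) → f a = f b)

/-- `v` is the right-hand value `f(t+)`: `f` is constantly `v` on some `(t, t+ε)`. -/
def RightVal {Y : Type*} (f : ℝ → Y) (t : ℝ) (v : Y) : Prop :=
  ∃ ε : ℝ, 0 < ε ∧ ∀ u : ℝ, t < u → u < t + ε → f u = v

/-- `v` is the left-hand value `f(t−)` (for `t > 0`): `f` is constantly `v` on some `(t-ε, t)`. -/
def LeftVal {Y : Type*} (f : ℝ → Y) (t : ℝ) (v : Y) : Prop :=
  ∃ ε : ℝ, 0 < ε ∧ ε ≤ t ∧ ∀ u : ℝ, t - ε < u → u < t → f u = v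

/-- `tm` is the (finite or infinite) increasing sequence of significant moments of a
track with status function `f`; a finite sequence is encoded by letting `tm` take the
value `⊤ = ∞` from some point on. -/
structure TrainMotion (dmin dmax : ℝ) (f : ℝ → TStat) (tm : ℕ → EReal) : Prop where
  zero : tm 0 = 0
  mono : Monotone tm
  strict : ∀ i, tm i ≠ ⊤ → tm i < tm (i + 1)
  last_div : ∀ k, tm k ≠ ⊤ → tm (k + 1) = ⊤ → 3 ∣ k
  status_empty : ∀ i : ℕ, ∀ u : ℝ, tm (3 * i) ≤ (u : EReal) → (u : EReal) < tm (3 * i + 1) →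
    f u = TStat.emp
  status_coming : ∀ i : ℕ, ∀ u : ℝ, tm (3 * i + 1) ≤ (u : EReal) → (u : EReal) < tm (3 * i + 2) →
    f u = TStat.coming
  status_cross : ∀ i : ℕ, ∀ u : ℝ, tm (3 * i + 2) ≤ (u : EReal) → (u : EReal) < tm (3 * i + 3) →
    f u = TStat.incrossing
  gap : ∀ i : ℕ, ∀ a b : ℝ, tm (3 * i + 1) = (a : EReal) → tm (3 * i + 2) = (b : EReal) →
    dmin ≤ b - a ∧ b - a ≤ dmax

/-- `SafeToOpen(t)`: every track is empty or its deadline is more than `dopen` away. -/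
def SafeToOpen {Tracks : Type*} (dopen : ℝ) (trackStatus : Tracks → ℝ → TStat)
    (deadline : Tracks → ℝ → EReal) (t : ℝ) : Prop :=
  ∀ x : Tracks, trackStatus x t = TStat.emp ∨ ((t + dopen : ℝ) : EReal) < deadline x t

/-- A regular run of the railroad-crossing evolving algebra.  `WaitTime = dmin - dclose`. -/
structure RegularRun (Tracks : Type*) (dmin dmax dopen dclose : ℝ) where
  trackStatus : Tracks → ℝ → TStat
  deadline : Tracks → ℝ → EReal
  dir : ℝ → DirV
  gate : ℝ → GateV
  /-- the right-hand value `Deadline(x, t+)` -/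
  deadlinePlus : Tracks → ℝ → EReal
  /-- the right-hand value `Dir(t+)` -/
  dirPlus : ℝ → DirV
  /-- the right-hand value `GateStatus(t+)` -/
  gatePlus : ℝ → GateV
  pwc_ts : ∀ x, PWC (trackStatus x)
  pwc_dl : ∀ x, PWC (deadline x)
  pwc_dir : PWC dir
  pwc_gate : PWC gate
  dlPlus_spec : ∀ x, ∀ t : ℝ, 0 ≤ t → RightVal (deadline x) t (deadlinePlus x t)
  dirPlus_spec : ∀ t : ℝ, 0 ≤ t → RightVal dir t (dirPlus t)
  gatePlus_spec : ∀ t : ℝ, 0 ≤ t → RightVal gate t (gatePlus t)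
  dl_left : ∀ x, ∀ t : ℝ, 0 < t → LeftVal (deadline x) t (deadline x t)
  dir_left : ∀ t : ℝ, 0 < t → LeftVal dir t (dir t)
  gate_left : ∀ t : ℝ, 0 < t → LeftVal gate t (gate t)
  trainMotion : ∀ x, ∃ tm : ℕ → EReal, TrainMotion dmin dmax (trackStatus x) tm
  dl_init : ∀ x, deadline x 0 = ⊤
  dir_init : dir 0 = DirV.opn
  gate_init : gate 0 = GateV.opened
  dl_step_coming : ∀ x, ∀ t : ℝ, 0 ≤ t → trackStatus x t = TStat.coming → deadline x t = ⊤ →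
    deadlinePlus x t = ((t + (dmin - dclose) : ℝ) : EReal)
  dl_step_empty : ∀ x, ∀ t : ℝ, 0 ≤ t → trackStatus x t = TStat.emp → deadline x t ≠ ⊤ →
    deadlinePlus x t = ⊤
  dl_step_other : ∀ x, ∀ t : ℝ, 0 ≤ t →
    ¬(trackStatus x t = TStat.coming ∧ deadline x t = ⊤) →
    ¬(trackStatus x t = TStat.emp ∧ deadline x t ≠ ⊤) →
    deadlinePlus x t = deadline x t
  dir_step_close : ∀ t : ℝ, 0 ≤ t → (∃ x, deadline x t = (t : EReal)) → dirPlus t = DirV.cls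
  dir_step_open : ∀ t : ℝ, 0 ≤ t → (∀ x, deadline x t ≠ (t : EReal)) → dir t = DirV.cls →
    SafeToOpen dopen trackStatus deadline t → dirPlus t = DirV.opn
  dir_step_other : ∀ t : ℝ, 0 ≤ t → (∀ x, deadline x t ≠ (t : EReal)) →
    ¬(dir t = DirV.cls ∧ SafeToOpen dopen trackStatus deadline t) → dirPlus t = dir t
  gate_step : ∀ t : ℝ, 0 ≤ t →
    gatePlus t = gate t ∨ (dir t = DirV.opn ∧ gatePlus t = GateV.opened) ∨
      (dir t = DirV.cls ∧ gatePlus t = GateV.closed)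
  gate_close_bound : ∀ t : ℝ, 0 ≤ t →
    ¬(∀ u ∈ Set.Ioo t (t + dclose), dir u = DirV.cls ∧ gate u = GateV.opened)
  gate_open_bound : ∀ t : ℝ, 0 ≤ t →
    ¬(∀ u ∈ Set.Ioo t (t + dopen), dir u = DirV.opn ∧ gate u = GateV.closed)

/-- Induction along the reals for a property that starts to hold right after `a`, passes to
left limits, and propagates to the right. -/
theorem forall_Ioc_of_left_of_right {P : ℝ → Prop} {a b : ℝ}
    (h0 : ∃ ε : ℝ, 0 < ε ∧ ∀ u, a < u → u < a + ε → P u)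
    (hl : ∀ t, a < t → t ≤ b → (∀ u, a < u → u < t → P u) → P t)
    (hr : ∀ t, a < t → t < b → P t → ∃ ε : ℝ, 0 < ε ∧ ∀ u, t < u → u < t + ε → P u) :
    ∀ t, a < t → t ≤ b → P t := by
  intro t hat htb
  by_contra hPt
  set S : Set ℝ := {s | a < s ∧ s ≤ b ∧ ¬ P s} with hS
  have htS : t ∈ S := ⟨hat, htb, hPt⟩
  have hbdd : BddBelow S := ⟨a, fun s hs => hs.1.le⟩
  obtain ⟨ε, hε, h0⟩ := h0
  have hm : a + ε ≤ sInf S := le_csInf ⟨t, htS⟩ fun s hs => by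
    by_contra! h
    exact hs.2.2 (h0 s hs.1 h)
  have hmt : sInf S ≤ t := csInf_le hbdd htS
  have hbelow : ∀ u, a < u → u < sInf S → P u := by
    intro u hau hu
    by_contra hP
    exact absurd (csInf_le hbdd (show u ∈ S from ⟨hau, by linarith, hP⟩)) (not_le.2 hu)
  have hPm : P (sInf S) := hl _ (by linarith) (by linarith) hbelow
  have hlt : sInf S < t := lt_of_le_of_ne hmt fun h => hPt (h ▸ hPm)
  obtain ⟨η, hη, hr⟩ := hr _ (by linarith) (by linarith) hPm
  have : sInf S + η ≤ sInf S := le_csInf ⟨t, htS⟩ fun s hs => by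
    by_contra! h
    rcases (csInf_le hbdd hs).lt_or_eq with h' | h'
    · exact hs.2.2 (hr s h' h)
    · exact hs.2.2 (h' ▸ hPm)
  linarith

/-- A left-continuous function with right-hand values satisfies on `(a, b]` every property of
its values that holds at `a+` and is preserved by jumps in `(a, b)`. -/
theorem forall_Ioc_of_step {Y : Type*} {f fp : ℝ → Y}
    (hL : ∀ t, 0 < t → LeftVal f t (f t)) (hR : ∀ t, 0 ≤ t → RightVal f t (fp t))
    {Q : Y → Prop} {a b : ℝ} (ha : 0 ≤ a) (h0 : Q (fp a))
    (hs : ∀ t, a < t → t < b → Q (f t) → Q (fp t)) :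
    ∀ t, a < t → t ≤ b → Q (f t) := by
  apply forall_Ioc_of_left_of_right
  · obtain ⟨ε, hε, h⟩ := hR a ha
    exact ⟨ε, hε, fun u h1 h2 => by rwa [h u h1 h2]⟩
  · intro t hat _ hu
    obtain ⟨ε, hε, _, h⟩ := hL t (by linarith)
    have h1 : max a (t - ε) < t := max_lt hat (by linarith)
    have ha' := le_max_left a (t - ε)
    have hε' := le_max_right a (t - ε)
    have := hu ((max a (t - ε) + t) / 2) (by linarith) (by linarith)
    rwa [h _ (by linarith) (by linarith)] at this
  · intro t hat htb hQ
    obtain ⟨ε, hε, h⟩ := hR t (by linarith)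
    exact ⟨ε, hε, fun u h1 h2 => by rw [h u h1 h2]; exact hs t hat htb hQ⟩

/-- A right-hand value is determined by any interval of constancy to the right. -/
theorem RightVal.eq_of_forall {Y : Type*} {f : ℝ → Y} {t b : ℝ} {v w : Y} (h : RightVal f t v)
    (htb : t < b) (hw : ∀ u, t < u → u < b → f u = w) : v = w := by
  obtain ⟨ε, hε, h⟩ := h
  have hm : t < min (t + ε) b := lt_min (by linarith) htb
  have h1 := min_le_left (t + ε) b
  have h2 := min_le_right (t + ε) b
  rw [← h ((t + min (t + ε) b) / 2) (by linarith) (by linarith),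
    hw _ (by linarith) (by linarith)]

namespace TrainMotion

variable {dmin dmax : ℝ} {f : ℝ → TStat} {tm : ℕ → EReal}

theorem nonneg (h : TrainMotion dmin dmax f tm) (k : ℕ) : 0 ≤ tm k := by
  rw [← h.zero]; exact h.mono (Nat.zero_le k)

theorem cycle_lower_bound (h : TrainMotion dmin dmax f tm) (k : ℕ) :
    ((k * dmin : ℝ) : EReal) ≤ tm (3 * k) := by
  induction k with
  | zero => simp [h.zero]
  | succ k ih =>
    have h01 : tm (3 * k) ≤ tm (3 * k + 1) := h.mono (by omega)
    have h23 : tm (3 * k + 2) ≤ tm (3 * (k + 1)) := h.mono (by omega)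
    by_cases h2 : tm (3 * k + 2) = ⊤
    · rw [h2, top_le_iff] at h23
      exact h23 ▸ le_top
    have h1 : tm (3 * k + 1) ≠ ⊤ := fun e => h2 (top_le_iff.1 (e ▸ h.mono (by omega)))
    have hb1 : tm (3 * k + 1) ≠ ⊥ := ne_bot_of_le_ne_bot (by simp) (h.nonneg _)
    have hb2 : tm (3 * k + 2) ≠ ⊥ := ne_bot_of_le_ne_bot (by simp) (h.nonneg _)
    lift tm (3 * k + 1) to ℝ using ⟨h1, hb1⟩ with a ha
    lift tm (3 * k + 2) to ℝ using ⟨h2, hb2⟩ with b hb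
    have hg := (h.gap k a b ha.symm hb.symm).1
    refine le_trans ?_ h23
    have hka := ih.trans h01
    rw [EReal.coe_le_coe_iff] at hka ⊢
    push_cast
    linarith

theorem exists_mem_Ico (h : TrainMotion dmin dmax f tm) (hd : 0 < dmin) {t : ℝ} (ht : 0 ≤ t) :
    ∃ k, tm k ≤ (t : EReal) ∧ (t : EReal) < tm (k + 1) := by
  have hex : ∃ k, (t : EReal) < tm k := by
    obtain ⟨n, hn⟩ := exists_nat_gt (t / dmin)
    refine ⟨3 * n, lt_of_lt_of_le ?_ (h.cycle_lower_bound n)⟩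
    rw [EReal.coe_lt_coe_iff]
    exact (div_lt_iff₀ hd).1 hn
  classical
  obtain ⟨k, hk⟩ : ∃ k, Nat.find hex = k + 1 := by
    refine Nat.exists_eq_succ_of_ne_zero fun h0 => ?_
    have := Nat.find_spec hex
    rw [h0, h.zero] at this
    exact absurd this (not_lt.2 (by exact_mod_cast ht))
  exact ⟨k, not_lt.1 (Nat.find_min hex (by omega)), hk ▸ Nat.find_spec hex⟩

/-- A coming train has been coming since some moment `a`, and stays so for at least `dmin`
after it. -/
theorem exists_coming_start (h : TrainMotion dmin dmax f tm) (hd : 0 < dmin) {t : ℝ}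
    (ht : 0 ≤ t) (hc : f t = TStat.coming) :
    ∃ a, 0 ≤ a ∧ a ≤ t ∧ (∀ u, a ≤ u → u ≤ t → f u = TStat.coming) ∧
      ∀ u, a ≤ u → u < a + dmin → f u = TStat.coming := by
  obtain ⟨k, hk1, hk2⟩ := h.exists_mem_Ico hd ht
  obtain ⟨i, rfl | rfl | rfl⟩ : ∃ i, k = 3 * i ∨ k = 3 * i + 1 ∨ k = 3 * i + 2 :=
    ⟨k / 3, by omega⟩
  · simp [h.status_empty i t hk1 hk2] at hc
  · have h1 : tm (3 * i + 1) ≠ ⊤ := ne_top_of_le_ne_top (EReal.coe_ne_top t) hk1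
    have h2 : tm (3 * i + 2) ≠ ⊤ := fun e => by
      have := h.last_div _ h1 e
      omega
    have hb1 : tm (3 * i + 1) ≠ ⊥ := ne_bot_of_le_ne_bot (by simp) (h.nonneg _)
    have hb2 : tm (3 * i + 2) ≠ ⊥ := ne_bot_of_le_ne_bot (by simp) (h.nonneg _)
    obtain ⟨a, ha⟩ : ∃ a : ℝ, tm (3 * i + 1) = a := ⟨_, (EReal.coe_toReal h1 hb1).symm⟩
    obtain ⟨b, hb⟩ : ∃ b : ℝ, tm (3 * i + 2) = b := ⟨_, (EReal.coe_toReal h2 hb2).symm⟩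
    have hg := (h.gap i a b ha hb).1
    have hcoming : ∀ u, a ≤ u → u < b → f u = TStat.coming := fun u hu1 hu2 =>
      h.status_coming i u (by rw [ha]; exact_mod_cast hu1) (by rw [hb]; exact_mod_cast hu2)
    have ha0 : 0 ≤ a := by
      have := h.nonneg (3 * i + 1)
      rw [ha] at this
      exact_mod_cast this
    have hat : a ≤ t := by
      rw [ha] at hk1
      exact_mod_cast hk1
    have htb : t < b := by
      rw [show 3 * i + 1 + 1 = 3 * i + 2 from rfl, hb] at hk2
      exact_mod_cast hk2
    exact ⟨a, ha0, hat, fun u hu1 hu2 => hcoming u hu1 (by linarith),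
      fun u hu1 hu2 => hcoming u hu1 (by linarith)⟩
  · simp [h.status_cross i t hk1 hk2] at hc

end TrainMotion

/-- The gate status requested by a direction. -/
def DirV.target : DirV → GateV
  | .opn => .opened
  | .cls => .closed

theorem DirV.target_injective : Function.Injective DirV.target := by
  intro a b h
  cases a <;> cases b <;> simp_all [DirV.target]

namespace RegularRun

variable {Tracks : Type*} {dmin dmax dopen dclose : ℝ}

theorem deadlinePlus_ne_top (R : RegularRun Tracks dmin dmax dopen dclose) {x : Tracks} {t : ℝ}
    (ht : 0 ≤ t) (hc : R.trackStatus x t = TStat.coming) : R.deadlinePlus x t ≠ ⊤ := by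
  by_cases h : R.deadline x t = ⊤
  · rw [R.dl_step_coming x t ht hc h]
    exact EReal.coe_ne_top _
  · rw [R.dl_step_other x t ht (by simp [h]) (by simp [hc])]
    exact h

/-- The deadline is infinite only at the first moment of a coming period. -/
theorem coming_of_deadline_eq_top (R : RegularRun Tracks dmin dmax dopen dclose)
    (hdmin : 0 < dmin) {x : Tracks} {t : ℝ} (ht : 0 ≤ t)
    (hc : R.trackStatus x t = TStat.coming) (hd : R.deadline x t = ⊤) :
    ∀ u, t ≤ u → u < t + dmin → R.trackStatus x u = TStat.coming := by
  obtain ⟨tm, h⟩ := R.trainMotion x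
  obtain ⟨a, ha0, hat, hcat, hca⟩ := h.exists_coming_start hdmin ht hc
  rcases hat.lt_or_eq with hlt | rfl
  · refine absurd hd ?_
    refine forall_Ioc_of_step (Q := fun y => y ≠ ⊤) (R.dl_left x) (R.dlPlus_spec x) ha0
      (R.deadlinePlus_ne_top ha0 (hcat a le_rfl hat)) ?_ t hlt le_rfl
    intro s hs1 hs2 _
    exact R.deadlinePlus_ne_top (by linarith) (hcat s hs1.le hs2.le)
  · exact hca

/-- A finite deadline was set `WaitTime` after the start of a coming period. -/
theorem deadline_eq_top_or_coming (R : RegularRun Tracks dmin dmax dopen dclose)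
    (hdmin : 0 < dmin) (x : Tracks) {t : ℝ} (ht : 0 < t) :
    R.deadline x t = ⊤ ∨ ∃ a : ℝ, R.deadline x t = ((a + (dmin - dclose) : ℝ) : EReal) ∧
      ∀ u, a ≤ u → u < a + dmin → R.trackStatus x u = TStat.coming := by
  set Q : EReal → Prop := fun y => y = ⊤ ∨ ∃ a : ℝ, y = ((a + (dmin - dclose) : ℝ) : EReal) ∧
      ∀ u, a ≤ u → u < a + dmin → R.trackStatus x u = TStat.coming with hQ
  have step : ∀ s, 0 ≤ s → Q (R.deadline x s) → Q (R.deadlinePlus x s) := by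
    intro s hs hQs
    by_cases h1 : R.trackStatus x s = TStat.coming ∧ R.deadline x s = ⊤
    · exact Or.inr ⟨s, R.dl_step_coming x s hs h1.1 h1.2,
        R.coming_of_deadline_eq_top hdmin hs h1.1 h1.2⟩
    by_cases h2 : R.trackStatus x s = TStat.emp ∧ R.deadline x s ≠ ⊤
    · exact Or.inl (R.dl_step_empty x s hs h2.1 h2.2)
    · rwa [R.dl_step_other x s hs h1 h2]
  exact forall_Ioc_of_step (Q := Q) (R.dl_left x) (R.dlPlus_spec x) le_rfl
    (step 0 le_rfl (Or.inl (R.dl_init x))) (fun s hs _ => step s hs.le) t ht le_rfl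

theorem dir_eq_cls_of_closing (R : RegularRun Tracks dmin dmax dopen dclose)
    (hdmin : 0 < dmin) (hdopen : 0 < dopen) (hcm : dclose < dmin) {t : ℝ}
    (ht : 0 < t) (h : R.dir t = DirV.opn) (hp : R.dirPlus t = DirV.cls) :
    ∀ u, t < u → u ≤ t + dclose → R.dir u = DirV.cls := by
  obtain ⟨x, hx⟩ : ∃ x, R.deadline x t = (t : EReal) := by
    by_contra! hne
    have := R.dir_step_other t ht.le hne (by simp [h])
    simp [this, h] at hp
  obtain ⟨a, ha, hcom⟩ := (R.deadline_eq_top_or_coming hdmin x ht).resolve_left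
    (by rw [hx]; exact EReal.coe_ne_top t)
  have hta : t = a + (dmin - dclose) := by
    rw [hx] at ha
    exact_mod_cast ha
  have hc : ∀ u, t ≤ u → u < t + dclose → R.trackStatus x u = TStat.coming := fun u h1 h2 =>
    hcom u (by linarith) (by linarith)
  by_cases hpos : 0 < dclose
  swap
  · intro u h1 h2
    linarith
  have step : ∀ s, t ≤ s → s < t + dclose → R.deadline x s = (t : EReal) →
      R.deadlinePlus x s = (t : EReal) := fun s hs1 hs2 hs => by
    rw [R.dl_step_other x s (by linarith) (by simp [hs]) (by simp [hc s hs1 hs2]), hs]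
  have hdl := forall_Ioc_of_step (Q := fun y => y = (t : EReal)) (b := t + dclose)
    (R.dl_left x) (R.dlPlus_spec x) ht.le (step t le_rfl (by linarith) hx)
    (fun s hs1 hs2 => step s hs1.le hs2)
  refine forall_Ioc_of_step (Q := fun y => y = DirV.cls) R.dir_left R.dirPlus_spec ht.le hp ?_
  intro s hs1 hs2 hs
  by_cases he : ∃ y, R.deadline y s = (s : EReal)
  · exact R.dir_step_close s (by linarith) he
  push Not at he
  rw [R.dir_step_other s (by linarith) he, hs]
  rintro ⟨_, hsafe⟩
  rcases hsafe x with h' | h'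
  · simp [hc s hs1.le hs2] at h'
  · rw [hdl s hs1 hs2.le, EReal.coe_lt_coe_iff] at h'
    linarith

theorem dir_eq_opn_of_opening (R : RegularRun Tracks dmin dmax dopen dclose)
    (hWT : dclose + dopen ≤ dmin) {t : ℝ}
    (ht : 0 < t) (h : R.dir t = DirV.cls) (hp : R.dirPlus t = DirV.opn) :
    ∀ u, t < u → u ≤ t + dopen → R.dir u = DirV.opn := by
  have hne : ∀ x, R.deadline x t ≠ (t : EReal) := by
    intro x hx
    simp [R.dir_step_close t ht.le ⟨x, hx⟩] at hp
  have hsafe : SafeToOpen dopen R.trackStatus R.deadline t := by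
    by_contra hns
    have := R.dir_step_other t ht.le hne (by simp [hns])
    simp [this, h] at hp
  have step : ∀ x s, t ≤ s →
      (R.trackStatus x s = TStat.emp ∨ ((t + dopen : ℝ) : EReal) ≤ R.deadline x s) →
      ((t + dopen : ℝ) : EReal) ≤ R.deadlinePlus x s := by
    intro x s hs hor
    have hs0 : 0 ≤ s := by linarith
    by_cases h1 : R.trackStatus x s = TStat.coming ∧ R.deadline x s = ⊤
    · rw [R.dl_step_coming x s hs0 h1.1 h1.2, EReal.coe_le_coe_iff]
      linarith
    by_cases h2 : R.trackStatus x s = TStat.emp ∧ R.deadline x s ≠ ⊤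
    · rw [R.dl_step_empty x s hs0 h2.1 h2.2]
      exact le_top
    rw [R.dl_step_other x s hs0 h1 h2]
    rcases hor with he | he
    · have : R.deadline x s = ⊤ := by
        by_contra hn
        exact h2 ⟨he, hn⟩
      rw [this]
      exact le_top
    · exact he
  have hdl : ∀ x s, t < s → ((t + dopen : ℝ) : EReal) ≤ R.deadline x s := fun x s hs =>
    forall_Ioc_of_step (Q := fun y => ((t + dopen : ℝ) : EReal) ≤ y) (R.dl_left x)
      (R.dlPlus_spec x) ht.le (step x t le_rfl ((hsafe x).imp_right le_of_lt))
      (fun r hr _ hq => step x r hr.le (Or.inr hq)) s hs le_rfl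
  refine forall_Ioc_of_step (Q := fun y => y = DirV.opn) R.dir_left R.dirPlus_spec ht.le hp ?_
  intro s hs1 hs2 hs
  rw [R.dir_step_other s (by linarith) _ (by simp [hs]), hs]
  intro x hx
  have := hdl x s hs1
  rw [hx, EReal.coe_le_coe_iff] at this
  linarith

/-- After a change, `Dir` keeps its new value long enough for the gate to follow. -/
theorem exists_gate_eq_target (R : RegularRun Tracks dmin dmax dopen dclose)
    (hdmin : 0 < dmin) (hdopen : 0 < dopen) (hcm : dclose < dmin)
    (hWT : dclose + dopen ≤ dmin) {t : ℝ} (ht : 0 < t) (h : R.dirPlus t ≠ R.dir t) :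
    (∀ s, t < s → s ≤ t + min dopen dclose → R.dir s = R.dirPlus t) ∧
    ∃ u, t < u ∧ (∀ s, t < s → s ≤ u → R.dir s = R.dirPlus t) ∧
      R.gate u = (R.dirPlus t).target := by
  have hmo := min_le_left dopen dclose
  have hmc := min_le_right dopen dclose
  cases hd : R.dir t <;> cases hp : R.dirPlus t
  · simp [hd, hp] at h
  · have hk := R.dir_eq_cls_of_closing hdmin hdopen hcm ht hd hp
    refine ⟨fun s h1 h2 => hk s h1 (by linarith), ?_⟩
    have hb := R.gate_close_bound t ht.le
    push Not at hb
    obtain ⟨u, ⟨hu1, hu2⟩, hu⟩ := hb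
    refine ⟨u, hu1, fun s h1 h2 => hk s h1 (by linarith), ?_⟩
    have := hu (hk u hu1 hu2.le)
    cases hg : R.gate u <;> simp_all [DirV.target]
  · have hk := R.dir_eq_opn_of_opening hWT ht hd hp
    refine ⟨fun s h1 h2 => hk s h1 (by linarith), ?_⟩
    have hb := R.gate_open_bound t ht.le
    push Not at hb
    obtain ⟨u, ⟨hu1, hu2⟩, hu⟩ := hb
    refine ⟨u, hu1, fun s h1 h2 => hk s h1 (by linarith), ?_⟩
    have := hu (hk u hu1 hu2.le)
    cases hg : R.gate u <;> simp_all [DirV.target]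
  · simp [hd, hp] at h

theorem gatePlus_eq_or (R : RegularRun Tracks dmin dmax dopen dclose) {t : ℝ} (ht : 0 ≤ t) :
    R.gatePlus t = R.gate t ∨ R.gatePlus t = (R.dir t).target := by
  rcases R.gate_step t ht with h | ⟨h1, h2⟩ | ⟨h1, h2⟩
  · exact Or.inl h
  · exact Or.inr (by rw [h1, h2]; rfl)
  · exact Or.inr (by rw [h1, h2]; rfl)

theorem gatePlus_eq_of_gate_eq_target (R : RegularRun Tracks dmin dmax dopen dclose) {t : ℝ}
    (ht : 0 ≤ t) (h : R.gate t = (R.dir t).target) : R.gatePlus t = R.gate t := by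
  rcases R.gatePlus_eq_or ht with h' | h'
  · exact h'
  · rw [h', h]

/-- While `Dir` is constant, a gate that has reached the requested status keeps it. -/
theorem gate_eq_target_of_gatePlus (R : RegularRun Tracks dmin dmax dopen dclose) {v : DirV}
    {s t : ℝ} (hs : 0 ≤ s) (hst : s < t) (hg : R.gatePlus s = v.target)
    (hd : ∀ u, s < u → u < t → R.dir u = v) : R.gate t = v.target := by
  refine forall_Ioc_of_step (Q := fun y => y = v.target) R.gate_left R.gatePlus_spec hs hg ?_
    t hst le_rfl
  intro u h1 h2 hu
  rw [R.gatePlus_eq_of_gate_eq_target (by linarith) (by rw [hu, hd u h1 h2]), hu]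

/-- If the gate agrees with `Dir` when `Dir` changes, then until the next change of `Dir` the
gate changes exactly once. -/
theorem exists_unique_gate_change (R : RegularRun Tracks dmin dmax dopen dclose)
    (hdmin : 0 < dmin) (hdopen : 0 < dopen) (hcm : dclose < dmin)
    (hWT : dclose + dopen ≤ dmin) {a : ℝ} (ha : 0 < a) (h : R.dirPlus a ≠ R.dir a)
    (hg : R.gate a = (R.dir a).target) :
    ∃ d, a < d ∧ R.gatePlus d ≠ R.gate d ∧
      (∀ b, a < b → R.dirPlus b ≠ R.dir b → d < b) ∧
      (∀ t, a < t → (∀ s, a < s → s ≤ t → R.dir s = R.dirPlus a) →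
        R.gatePlus t ≠ R.gate t → t = d) ∧
      (∀ b, a < b → R.dirPlus b ≠ R.dir b → (∀ s, a < s → s ≤ b → R.dir s = R.dirPlus a) →
        R.gate b = (R.dir b).target) := by
  obtain ⟨-, u, hau, hdu, hgu⟩ := R.exists_gate_eq_target hdmin hdopen hcm hWT ha h
  have hga : R.gatePlus a = (R.dir a).target := by
    rw [R.gatePlus_eq_of_gate_eq_target ha.le hg, hg]
  obtain ⟨d, had, hdu', hd⟩ : ∃ d, a < d ∧ d < u ∧ R.gatePlus d ≠ R.gate d := by
    by_contra! hno
    have := forall_Ioc_of_step (Q := fun y => y = (R.dir a).target) R.gate_left R.gatePlus_spec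
      ha.le hga (fun s h1 h2 hs => by rw [hno s h1 h2, hs]) u hau le_rfl
    exact h (DirV.target_injective (hgu.symm.trans this))
  have hnext : ∀ b, a < b → R.dirPlus b ≠ R.dir b → u ≤ b := by
    intro b hab hb
    by_contra! hbu
    apply hb
    rw [hdu b hab hbu.le]
    exact (R.dirPlus_spec b (by linarith)).eq_of_forall hbu fun s h1 h2 =>
      hdu s (by linarith) h2.le
  have hchange : ∀ t, a < t → R.dir t = R.dirPlus a → R.gatePlus t ≠ R.gate t →
      R.gatePlus t = (R.dirPlus a).target ∧ R.gate t ≠ (R.dirPlus a).target := by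
    intro t hat hdt ht
    have := (R.gatePlus_eq_or (by linarith)).resolve_left ht
    rw [hdt] at this
    exact ⟨this, fun e => ht (this.trans e.symm)⟩
  have hd' := hchange d had (hdu d had hdu'.le) hd
  refine ⟨d, had, hd, fun b h1 h2 => lt_of_lt_of_le hdu' (hnext b h1 h2), ?_, ?_⟩
  · intro t hat hdt ht
    have ht' := hchange t hat (hdt t hat le_rfl) ht
    rcases lt_trichotomy t d with hlt | heq | hlt
    · exact absurd (R.gate_eq_target_of_gatePlus (by linarith) hlt ht'.1
        fun s h1 h2 => hdu s (by linarith) (by linarith)) hd'.2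
    · exact heq
    · exact absurd (R.gate_eq_target_of_gatePlus (by linarith) hlt hd'.1
        fun s h1 h2 => hdt s (by linarith) h2.le) ht'.2
  · intro b hab hb hdb
    have := hnext b hab hb
    rw [hdb b hab le_rfl]
    exact R.gate_eq_target_of_gatePlus (by linarith) (by linarith) hd'.1
        fun s h1 h2 => hdb s (by linarith) h2.le

theorem add_min_le_of_dir_changes (R : RegularRun Tracks dmin dmax dopen dclose)
    (hdmin : 0 < dmin) (hdopen : 0 < dopen) (hcm : dclose < dmin)
    (hWT : dclose + dopen ≤ dmin) {a b : ℝ} (ha : 0 < a) (hab : a < b)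
    (h : R.dirPlus a ≠ R.dir a) (hb : R.dirPlus b ≠ R.dir b) : a + min dopen dclose ≤ b := by
  have hk := (R.exists_gate_eq_target hdmin hdopen hcm hWT ha h).1
  by_contra! hlt
  apply hb
  rw [hk b hab hlt.le]
  exact (R.dirPlus_spec b (by linarith)).eq_of_forall hlt fun s h1 h2 =>
    hk s (by linarith) h2.le

theorem dir_eq_dirPlus_of_no_change (R : RegularRun Tracks dmin dmax dopen dclose) {a b : ℝ}
    (ha : 0 ≤ a) (h : ∀ t, a < t → t < b → R.dirPlus t = R.dir t) :
    ∀ t, a < t → t ≤ b → R.dir t = R.dirPlus a :=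
  forall_Ioc_of_step (Q := fun y => y = R.dirPlus a) R.dir_left R.dirPlus_spec ha rfl
    fun t h1 h2 ht => (h t h1 h2).trans ht

/-- Before the first change of `Dir` the gate is in the requested status. -/
theorem gate_eq_target_of_no_change (R : RegularRun Tracks dmin dmax dopen dclose) {b : ℝ}
    (hb : 0 < b) (h : ∀ t, 0 < t → t < b → R.dirPlus t = R.dir t) :
    R.gate b = (R.dir b).target := by
  have hg0 : R.gatePlus 0 = R.gate 0 :=
    R.gatePlus_eq_of_gate_eq_target le_rfl (by rw [R.gate_init, R.dir_init]; rfl)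
  have hd0 : R.dirPlus 0 = R.dir 0 :=
    R.dir_step_other 0 le_rfl (fun x => by simp [R.dl_init x]) (by simp [R.dir_init])
  have hd := R.dir_eq_dirPlus_of_no_change le_rfl h
  rw [hd b hb le_rfl]
  refine R.gate_eq_target_of_gatePlus le_rfl hb ?_ fun u h1 h2 => hd u h1 h2.le
  rw [hg0, hd0, R.gate_init, R.dir_init]
  rfl

/-- The changes of the gate interleave with the changes of `Dir`, where the latter are
enumerated increasingly by an initial segment `p` of the natural numbers. -/
theorem exists_gate_changes (R : RegularRun Tracks dmin dmax dopen dclose)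
    (hdmin : 0 < dmin) (hdopen : 0 < dopen) (hdclose : 0 < dclose) (hcm : dclose < dmin)
    (hWT : dclose + dopen ≤ dmin) {p : ℕ → Prop} (hp : ∀ i, p (i + 1) → p i) {γ : ℕ → ℝ}
    (hmono : ∀ i, p (i + 1) → γ i < γ (i + 1))
    (hγ : ∀ i, p i → 0 < γ i ∧ R.dirPlus (γ i) ≠ R.dir (γ i))
    (hall : ∀ t, 0 < t → R.dirPlus t ≠ R.dir t → ∃ i, p i ∧ t = γ i) :
    ∃ δ : ℕ → ℝ, (∀ i, p i → R.gatePlus (δ i) ≠ R.gate (δ i) ∧ γ i < δ i) ∧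
      (∀ i, p (i + 1) → δ i < γ (i + 1)) ∧
      (∀ t, 0 < t → R.gatePlus t ≠ R.gate t → ∃ i, p i ∧ t = δ i) := by
  have hlt : ∀ i j, i < j → p j → p i ∧ γ i < γ j := by
    intro i j hij
    induction j, hij using Nat.le_induction with
    | base => exact fun hj => ⟨hp i hj, hmono i hj⟩
    | succ j _ ih =>
      intro hj
      obtain ⟨h1, h2⟩ := ih (hp j hj)
      exact ⟨h1, h2.trans (hmono j hj)⟩
  have hno : ∀ i, p i → ∀ b, (∀ j, p j → γ j < b → j ≤ i) → ∀ s, γ i < s → s ≤ b →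
      R.dir s = R.dirPlus (γ i) := by
    intro i hi b hb
    refine R.dir_eq_dirPlus_of_no_change (hγ i hi).1.le fun t h1 h2 => ?_
    by_contra hc
    obtain ⟨j, hj, rfl⟩ := hall t ((hγ i hi).1.trans h1) hc
    rcases (hb j hj h2).lt_or_eq with hji | rfl
    · exact absurd (hlt j i hji hi).2 h1.not_gt
    · exact lt_irrefl _ h1
  have hseg : ∀ i, p (i + 1) → ∀ s, γ i < s → s ≤ γ (i + 1) → R.dir s = R.dirPlus (γ i) := by
    intro i hi
    refine hno i (hp i hi) _ fun j hj hji => ?_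
    by_contra! hij
    rcases (Nat.succ_le_of_lt hij).lt_or_eq with h | h
    · exact absurd (hlt _ _ h hj).2 hji.not_gt
    · exact absurd hji (by rw [← h]; exact lt_irrefl _)
  have hgate : ∀ i, p i → R.gate (γ i) = (R.dir (γ i)).target := by
    intro i
    induction i with
    | zero =>
      intro h0
      refine R.gate_eq_target_of_no_change (hγ 0 h0).1 fun t h1 h2 => ?_
      by_contra hc
      obtain ⟨j, hj, rfl⟩ := hall t h1 hc
      rcases Nat.eq_zero_or_pos j with rfl | hj0
      · exact lt_irrefl _ h2
      · exact absurd (hlt 0 j hj0 hj).2 h2.not_gt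
    | succ i ih =>
      intro hi
      have hi' := hp i hi
      obtain ⟨_, _, _, _, _, h⟩ := R.exists_unique_gate_change hdmin hdopen hcm hWT
        (hγ i hi').1 (hγ i hi').2 (ih hi')
      exact h _ (hmono i hi) (hγ _ hi).2 (hseg i hi)
  have hex : ∀ i, ∃ d, p i → γ i < d ∧ R.gatePlus d ≠ R.gate d ∧
      (∀ b, γ i < b → R.dirPlus b ≠ R.dir b → d < b) ∧
      (∀ t, γ i < t → (∀ s, γ i < s → s ≤ t → R.dir s = R.dirPlus (γ i)) →
        R.gatePlus t ≠ R.gate t → t = d) := by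
    intro i
    by_cases hi : p i
    · obtain ⟨d, h1, h2, h3, h4, _⟩ := R.exists_unique_gate_change hdmin hdopen hcm hWT
        (hγ i hi).1 (hγ i hi).2 (hgate i hi)
      exact ⟨d, fun _ => ⟨h1, h2, h3, h4⟩⟩
    · exact ⟨0, fun h => absurd h hi⟩
  choose δ hδ using hex
  refine ⟨δ, fun i hi => ⟨(hδ i hi).2.1, (hδ i hi).1⟩, fun i hi =>
    (hδ i (hp i hi)).2.2.1 _ (hmono i hi) (hγ _ hi).2, fun t ht hc => ?_⟩
  have hm : 0 < min dopen dclose := lt_min hdopen hdclose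
  have hgrow : ∀ i : ℕ, p i → i * min dopen dclose < γ i := by
    intro i
    induction i with
    | zero => intro h; simpa using (hγ 0 h).1
    | succ i ih =>
      intro hi
      have h1 := ih (hp i hi)
      have h2 := R.add_min_le_of_dir_changes hdmin hdopen hcm hWT (hγ i (hp i hi)).1
        (hmono i hi) (hγ i (hp i hi)).2 (hγ _ hi).2
      push_cast
      linarith
  obtain ⟨N, hN⟩ := exists_nat_gt (t / min dopen dclose)
  rw [div_lt_iff₀ hm] at hN
  have hbound : ∀ j, p j → γ j < t → j ≤ N := by
    intro j hj hjt
    have h1 := hgrow j hj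
    have h2 : (j : ℝ) * min dopen dclose < N * min dopen dclose := by linarith
    exact_mod_cast (lt_of_mul_lt_mul_right h2 hm.le).le
  classical
  by_cases hsome : ∃ j, p j ∧ γ j < t
  · obtain ⟨j, hj, hjt⟩ := hsome
    have hspec := Nat.findGreatest_spec (P := fun j => p j ∧ γ j < t) (hbound j hj hjt) ⟨hj, hjt⟩
    have hmax : ∀ k, p k → γ k < t → k ≤ Nat.findGreatest (fun j => p j ∧ γ j < t) N :=
      fun k hk hkt => Nat.le_findGreatest (hbound k hk hkt) ⟨hk, hkt⟩
    exact ⟨_, hspec.1, (hδ _ hspec.1).2.2.2 t hspec.2 (hno _ hspec.1 t hmax) hc⟩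
  · push Not at hsome
    refine absurd (R.gatePlus_eq_of_gate_eq_target ht.le
      (R.gate_eq_target_of_no_change ht fun s h1 h2 => ?_)) hc
    by_contra hs
    obtain ⟨j, hj, rfl⟩ := hall s h1 hs
    exact absurd h2 (hsome j hj).not_gt

end RegularRun

theorem dir_and_gate_status_corollary {Tracks : Type*} [Fintype Tracks] [Nonempty Tracks]
    {dmin dmax dopen dclose : ℝ}
    (hdmin : 0 < dmin) (hdmax : 0 < dmax) (hdopen : 0 < dopen) (hdclose : 0 < dclose)
    (hcm : dclose < dmin) (hmm : dmin ≤ dmax)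
    (R : RegularRun Tracks dmin dmax dopen dclose)
    (hWT : dclose + dopen ≤ dmin) :
    ((∀ γ : ℕ → ℝ, StrictMono γ →
        (∀ i : ℕ, 0 < γ i ∧ R.dirPlus (γ i) ≠ R.dir (γ i)) →
        (∀ t : ℝ, 0 < t → R.dirPlus t ≠ R.dir t → ∃ i : ℕ, t = γ i) →
        ∃ δ : ℕ → ℝ, StrictMono δ ∧
          (∀ i : ℕ, 0 < δ i ∧ R.gatePlus (δ i) ≠ R.gate (δ i)) ∧
          (∀ t : ℝ, 0 < t → R.gatePlus t ≠ R.gate t → ∃ i : ℕ, t = δ i) ∧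
          (∀ i : ℕ, δ i ∈ Set.Ioo (γ i) (γ (i + 1)))) ∧
      (∀ n : ℕ, ∀ γ : ℕ → ℝ,
        (∀ i : ℕ, i + 1 < n → γ i < γ (i + 1)) →
        (∀ i < n, 0 < γ i ∧ R.dirPlus (γ i) ≠ R.dir (γ i)) →
        (∀ t : ℝ, 0 < t → R.dirPlus t ≠ R.dir t → ∃ i < n, t = γ i) →
        ∃ δ : ℕ → ℝ,
          (∀ i : ℕ, i + 1 < n → δ i < δ (i + 1)) ∧
          (∀ i < n, 0 < δ i ∧ R.gatePlus (δ i) ≠ R.gate (δ i)) ∧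
          (∀ t : ℝ, 0 < t → R.gatePlus t ≠ R.gate t → ∃ i < n, t = δ i) ∧
          (∀ i : ℕ, i + 1 < n → δ i ∈ Set.Ioo (γ i) (γ (i + 1))) ∧
          (∀ i : ℕ, i + 1 = n → γ i < δ i))) := by
  refine ⟨fun γ hmono hγ hall => ?_, fun n γ hmono hγ hall => ?_⟩
  · obtain ⟨δ, h1, h2, h3⟩ := R.exists_gate_changes hdmin hdopen hdclose hcm hWT
      (p := fun _ => True) (fun _ _ => trivial) (fun i _ => hmono i.lt_succ_self)
      (fun i _ => hγ i) (fun t ht hc => (hall t ht hc).imp fun i hi => ⟨trivial, hi⟩)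
    exact ⟨δ, strictMono_nat_of_lt_succ fun i => (h2 i trivial).trans (h1 (i + 1) trivial).2,
      fun i => ⟨(hγ i).1.trans (h1 i trivial).2, (h1 i trivial).1⟩,
      fun t ht hc => (h3 t ht hc).imp fun i hi => hi.2,
      fun i => ⟨(h1 i trivial).2, h2 i trivial⟩⟩
  · obtain ⟨δ, h1, h2, h3⟩ := R.exists_gate_changes hdmin hdopen hdclose hcm hWT
      (p := fun i => i < n) (fun i hi => by omega) hmono hγ hall
    exact ⟨δ, fun i hi => (h2 i hi).trans (h1 (i + 1) hi).2,
      fun i hi => ⟨(hγ i hi).1.trans (h1 i hi).2, (h1 i hi).1⟩, h3,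
      fun i hi => ⟨(h1 i (by omega)).2, h2 i hi⟩, fun i hi => (h1 i (by omega)).2⟩

end RailCross
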